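/- arXiv:1906.08083 — 9 statements merged into one kernel-verified Lean document; each statement's English description precedes it below -/
import Mathlib

section
/- Let p and q be distinct odd primes. For all integers t and k with t ≥ 1, k ≥ 0, and gcd(t, pq) = 1, the Euler quotient satisfies ψ(t + k·p·q) ≡ ψ(t) + k·t⁻¹·(p−1)·(q−1) (mod pq), where t⁻¹ denotes the multiplicative inverse of t modulo pq. -/
/-- Euler quotient modulo `p*q`: for `gcd(t, pq) = 1` it is the unique integer in
`{0, ..., pq-1}` congruent to `(t^((p-1)(q-1)) - 1)/(pq)` modulo `pq`; it is `0` otherwise. -/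
def eulerQuotient (p q t : ℕ) : ℕ :=
  if Nat.gcd t (p * q) = 1 then ((t ^ ((p - 1) * (q - 1)) - 1) / (p * q)) % (p * q) else 0

/-- The binary threshold sequence over `F₂`: `s t = 0` if `ψ(t)/(pq) < 1/2`, else `1`. -/
def binSeq (p q t : ℕ) : ZMod 2 :=
  if 2 * eulerQuotient p q t < p * q then 0 else 1

/-- `D ℓ = { t : 0 ≤ t < pq², gcd(t, pq) = 1, ψ(t) ≡ p·ℓ (mod pq) }`. -/
def Dset (p q ℓ : ℕ) : Finset ℕ :=
  (Finset.range (p * q ^ 2)).filter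
    (fun t => Nat.gcd t (p * q) = 1 ∧ eulerQuotient p q t ≡ p * ℓ [MOD p * q])

theorem eulerQuotient_spec {p q t : ℕ} (hp : p.Prime) (hq : q.Prime) (hne : p ≠ q)
    (ht : 1 ≤ t) (hcop : Nat.gcd t (p * q) = 1) :
    ∃ a : ℕ, t ^ ((p - 1) * (q - 1)) = 1 + p * q * a ∧
      (eulerQuotient p q t : ZMod (p * q)) = a := by
  have htot : Nat.totient (p * q) = (p - 1) * (q - 1) := by
    rw [Nat.totient_mul ((Nat.coprime_primes hp hq).2 hne), Nat.totient_prime hp,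
      Nat.totient_prime hq]
  have hmod := Nat.ModEq.pow_totient (x := t) (n := p * q) hcop
  rw [htot] at hmod
  have hpos : 1 ≤ t ^ ((p - 1) * (q - 1)) := Nat.one_le_pow _ _ ht
  obtain ⟨a, ha⟩ := (Nat.modEq_iff_dvd' hpos).1 hmod.symm
  refine ⟨a, by omega, ?_⟩
  rw [eulerQuotient, if_pos hcop, ha, Nat.mul_div_cancel_left _ (Nat.mul_pos hp.pos hq.pos),
    ZMod.natCast_mod]

theorem stmt_0 (p q : ℕ) (hp : p.Prime) (hq : q.Prime) (hpodd : Odd p) (hqodd : Odd q)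
    (hne : p ≠ q) (t k : ℕ) (ht : 1 ≤ t) (hcop : Nat.gcd t (p * q) = 1) :
    ((eulerQuotient p q (t + k * (p * q)) : ZMod (p * q)) : ZMod (p * q)) =
      (eulerQuotient p q t : ZMod (p * q)) +
        (k : ZMod (p * q)) * (t : ZMod (p * q))⁻¹ *
          ((p - 1 : ℕ) : ZMod (p * q)) * ((q - 1 : ℕ) : ZMod (p * q)) := by
  have hN : 0 < p * q := Nat.mul_pos hp.pos hq.pos
  have hcop' : Nat.gcd (t + k * (p * q)) (p * q) = 1 := by
    rw [Nat.gcd_add_mul_right_left]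
    exact hcop
  obtain ⟨a, ha, hψa⟩ := eulerQuotient_spec hp hq hne ht hcop
  obtain ⟨b, hb, hψb⟩ := eulerQuotient_spec hp hq hne (Nat.le_add_right_of_le ht) hcop'
  rw [hψa, hψb]
  have hm : 0 < (p - 1) * (q - 1) :=
    Nat.mul_pos (Nat.sub_pos_of_lt hp.one_lt) (Nat.sub_pos_of_lt hq.one_lt)
  have hcast : (((p - 1) * (q - 1) : ℕ) : ZMod (p * q)) =
      ((p - 1 : ℕ) : ZMod (p * q)) * ((q - 1 : ℕ) : ZMod (p * q)) := Nat.cast_mul _ _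
  rw [mul_assoc _ ((p - 1 : ℕ) : ZMod (p * q)), ← hcast]
  generalize (p - 1) * (q - 1) = m at *
  generalize p * q = N at *
  obtain ⟨c, hc⟩ := Polynomial.powAddExpansion t (k * N) m
  have hquot : b = a + m * t ^ (m - 1) * k + c * k ^ 2 * N := by
    refine Nat.eq_of_mul_eq_mul_left hN ?_
    rw [hb, ha] at hc
    linarith
  have hinv : (t : ZMod N)⁻¹ = (t : ZMod N) ^ (m - 1) := by
    have hpow : (t : ZMod N) * (t : ZMod N) ^ (m - 1) = 1 := by
      rw [mul_pow_sub_one hm.ne', ← Nat.cast_pow, ha]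
      simp
    exact ZMod.inv_eq_of_mul_eq_one N _ _ hpow
  rw [hquot, hinv]
  push_cast
  rw [ZMod.natCast_self]
  ring
end

section
/- Let p and q be distinct odd primes with p dividing q − 1. For every integer t ≥ 1 with gcd(t, pq) = 1, the Euler quotient ψ(t) is divisible by p. -/
/-- Euler's theorem, with an exponent that is a multiple of the totient. -/
theorem dvd_pow_sub_one_of_totient_dvd {n t e : ℕ} (h : Nat.Coprime t n)
    (he : Nat.totient n ∣ e) : n ∣ t ^ e - 1 := by
  rcases he with ⟨k, rfl⟩
  have hd : n ∣ t ^ n.totient - 1 := by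
    rcases Nat.eq_zero_or_pos (t ^ n.totient) with h0 | h1
    · simp [h0]
    · exact (Nat.modEq_iff_dvd' h1).mp (Nat.ModEq.pow_totient h).symm
  exact hd.trans (Nat.pow_sub_one_dvd_pow_sub_one t (dvd_mul_right _ k))

theorem stmt_2 (p q : ℕ) (hp : p.Prime) (hq : q.Prime) (hpodd : Odd p) (hqodd : Odd q)
    (hne : p ≠ q) (hdvd : p ∣ q - 1) (t : ℕ) (ht : 1 ≤ t)
    (hcop : Nat.gcd t (p * q) = 1) :
    p ∣ eulerQuotient p q t := by
  have hcp : Nat.Coprime t p := Nat.Coprime.coprime_mul_right_right hcop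
  have hcq : Nat.Coprime t q := Nat.Coprime.coprime_mul_left_right hcop
  have hp2 : p ^ 2 ∣ t ^ ((p - 1) * (q - 1)) - 1 := by
    refine dvd_pow_sub_one_of_totient_dvd (hcp.pow_right 2) ?_
    rw [Nat.totient_prime_pow hp two_pos, mul_comm]
    simpa using mul_dvd_mul_left (p - 1) hdvd
  have hq1 : q ∣ t ^ ((p - 1) * (q - 1)) - 1 := by
    refine dvd_pow_sub_one_of_totient_dvd hcq ?_
    rw [Nat.totient_prime hq]
    exact dvd_mul_left _ _
  have hpq : Nat.Coprime (p ^ 2) q := ((Nat.coprime_primes hp hq).mpr hne).pow_left 2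
  have hdiv : p * q * p ∣ t ^ ((p - 1) * (q - 1)) - 1 := by
    convert hpq.mul_dvd_of_dvd_of_dvd hp2 hq1 using 1
    ring
  rw [eulerQuotient, if_pos hcop]
  exact (Nat.dvd_mod_iff (dvd_mul_right p q)).mpr (Nat.dvd_div_of_mul_dvd hdiv)
end

section
/- Let p and q be distinct odd primes with p dividing q − 1. The binary threshold sequence s = (s_t)_{t≥0} derived from the Euler quotient modulo pq is purely periodic with least period exactly p·q²; in particular s_{t+pq²} = s_t for all t ≥ 0, while neither pq nor q² is a period of s. -/
/-- Adding a multiple of `m ^ 2` to `a` does not change `(a - 1) / m` modulo `m`. -/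
theorem add_mul_sq_sub_one_div_mod {a m : ℕ} (z : ℕ) (ha : 0 < a) (hm : 0 < m) :
    ((a + z * m ^ 2 - 1) / m) % m = ((a - 1) / m) % m := by
  have h : a + z * m ^ 2 - 1 = (a - 1) + z * m * m := by
    have : z * m ^ 2 = z * m * m := by ring
    omega
  rw [h, Nat.add_mul_div_right _ _ hm, Nat.add_mul_mod_self_right]

theorem eulerQuotient_add_period {p q : ℕ} (hp : 1 < p) (hq : 0 < q) (hdvd : p ∣ q - 1)
    (t : ℕ) : eulerQuotient p q (t + p * q ^ 2) = eulerQuotient p q t := by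
  have hgcd : Nat.gcd (t + p * q ^ 2) (p * q) = Nat.gcd t (p * q) := by
    rw [show p * q ^ 2 = q * (p * q) by ring, Nat.gcd_add_mul_right_left]
  simp only [eulerQuotient, hgcd]
  split_ifs with h
  · have ht : 0 < t := by
      rcases Nat.eq_zero_or_pos t with rfl | ht
      · rw [Nat.gcd_zero_left] at h
        exact absurd (Nat.eq_one_of_mul_eq_one_right h) hp.ne'
      · exact ht
    obtain ⟨c, hc⟩ := hdvd
    obtain ⟨k, hk⟩ := Polynomial.powAddExpansion t (p * q ^ 2) ((p - 1) * (q - 1))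
    have hz : (t + p * q ^ 2) ^ ((p - 1) * (q - 1)) = t ^ ((p - 1) * (q - 1)) +
        ((p - 1) * c * t ^ ((p - 1) * (q - 1) - 1) + k * q ^ 2) * (p * q) ^ 2 := by
      rw [hk]
      generalize t ^ ((p - 1) * (q - 1) - 1) = y
      rw [hc]
      push_cast
      ring
    rw [hz, add_mul_sq_sub_one_div_mod _ (by positivity) (by positivity)]
  · rfl

theorem eulerQuotient_one (p q : ℕ) : eulerQuotient p q 1 = 0 := by
  simp [eulerQuotient]

theorem eulerQuotient_one_add_mul {p q : ℕ} (hp : 1 < p) (hq : 1 < q) :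
    eulerQuotient p q (1 + p * q) = (p - 1) * (q - 1) := by
  have hpq : 0 < p * q := by positivity
  obtain ⟨k, hk⟩ := Polynomial.powAddExpansion 1 (p * q) ((p - 1) * (q - 1))
  have hlt : (p - 1) * (q - 1) < p * q := Nat.mul_lt_mul'' (by omega) (by omega)
  rw [eulerQuotient, if_pos (by simp), hk, add_mul_sq_sub_one_div_mod _ (by positivity) hpq]
  simp [Nat.mul_div_cancel _ hpq, Nat.mod_eq_of_lt hlt]

theorem binSeq_eq_zero_of_dvd {p q t : ℕ} (hp : 1 < p) (hq : 0 < q) (h : p ∣ t) :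
    binSeq p q t = 0 := by
  have hgcd : Nat.gcd t (p * q) ≠ 1 := fun h1 =>
    hp.ne' (Nat.dvd_one.mp (h1 ▸ Nat.dvd_gcd h (dvd_mul_right p q)))
  simp [binSeq, eulerQuotient, hgcd, hq.ne', show p ≠ 0 by omega]

theorem binSeq_one {p q : ℕ} (hp : 0 < p) (hq : 0 < q) : binSeq p q 1 = 0 := by
  simp [binSeq, eulerQuotient_one, hp, hq]

theorem binSeq_one_add_mul {p q : ℕ} (hp : 3 ≤ p) (hq : 4 ≤ q) :
    binSeq p q (1 + p * q) = 1 := by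
  rw [binSeq, eulerQuotient_one_add_mul (by omega) (by omega), if_neg]
  obtain ⟨a, rfl⟩ := Nat.exists_eq_add_of_le hp
  obtain ⟨b, rfl⟩ := Nat.exists_eq_add_of_le hq
  rw [show 3 + a - 1 = 2 + a by omega, show 4 + b - 1 = 3 + b by omega, not_lt]
  nlinarith [Nat.zero_le (a * b)]

/-- If `M > 0` and `N` are periods of a sequence, so is every multiple of `gcd N M`. -/
theorem periodic_of_gcd_dvd {α : Type*} {f : ℕ → α} {M N : ℕ} (hM : f.Periodic M)
    (hN : f.Periodic N) (hMpos : 0 < M) {d : ℕ} (hd : Nat.gcd N M ∣ d) : f.Periodic d := by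
  obtain ⟨e, rfl⟩ := hd
  suffices h : f.Periodic (Nat.gcd N M) by
    simpa [mul_comm] using h.nat_mul e
  rcases (Nat.gcd_le_right N hMpos).lt_or_eq with hlt | heq
  · obtain ⟨m, -, hm⟩ := Nat.exists_mul_mod_eq_gcd hlt
    intro t
    calc f (t + Nat.gcd N M) = f (t + Nat.gcd N M + (N * m / M) * M) := (hM.nat_mul _ _).symm
      _ = f (t + m * N) := by rw [add_assoc, ← hm, mul_comm _ M, Nat.mod_add_div, mul_comm m]
      _ = f t := hN.nat_mul m t
  · rwa [heq]

/-- A proper divisor of `p * q ^ 2` divides `p * q` or `q ^ 2`. -/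
theorem dvd_mul_or_dvd_sq_of_dvd_mul_sq {p q d : ℕ} (hp : p.Prime) (hq : q.Prime)
    (hd : d ∣ p * q ^ 2) (hne : d ≠ p * q ^ 2) : d ∣ p * q ∨ d ∣ q ^ 2 := by
  obtain ⟨e, he⟩ := hd
  have he1 : e ≠ 1 := by
    rintro rfl
    exact hne (by rw [he, mul_one])
  obtain ⟨r, hr, f, rfl⟩ := Nat.exists_prime_and_dvd he1
  have hrd : r ∣ p * q ^ 2 := ⟨d * f, by rw [he]; ring⟩
  rcases hr.dvd_mul.mp hrd with h | h
  · obtain rfl := (Nat.prime_dvd_prime_iff_eq hr hp).mp h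
    exact Or.inr ⟨f, Nat.eq_of_mul_eq_mul_left hr.pos (by rw [he]; ring)⟩
  · obtain rfl := (Nat.prime_dvd_prime_iff_eq hr hq).mp (hr.dvd_of_dvd_pow h)
    exact Or.inl ⟨f, Nat.eq_of_mul_eq_mul_left hr.pos (by linarith)⟩

theorem stmt_3 (p q : ℕ) (hp : p.Prime) (hq : q.Prime) (hpodd : Odd p) (hqodd : Odd q)
    (hne : p ≠ q) (hdvd : p ∣ q - 1) :
    (∀ t : ℕ, binSeq p q (t + p * q ^ 2) = binSeq p q t) ∧
    (¬ ∀ t : ℕ, binSeq p q (t + p * q) = binSeq p q t) ∧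
    (¬ ∀ t : ℕ, binSeq p q (t + q ^ 2) = binSeq p q t) ∧
    (∀ N : ℕ, 0 < N → (∀ t : ℕ, binSeq p q (t + N) = binSeq p q t) → p * q ^ 2 ≤ N) := by
  have hp1 := hp.one_lt
  have hq1 := hq.one_lt
  have hp3 : 3 ≤ p := by
    obtain ⟨k, rfl⟩ := hpodd
    omega
  have hq4 : 4 ≤ q := by
    have := Nat.le_of_dvd (by omega) hdvd
    omega
  have hper : ∀ t : ℕ, binSeq p q (t + p * q ^ 2) = binSeq p q t := fun t => by
    rw [binSeq, binSeq, eulerQuotient_add_period hp1 hq.pos hdvd]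
  have hpq : ¬ ∀ t : ℕ, binSeq p q (t + p * q) = binSeq p q t := fun h => by
    have h1 := h 1
    rw [binSeq_one_add_mul hp3 hq4, binSeq_one hp.pos hq.pos] at h1
    exact one_ne_zero h1
  have hqq : ¬ ∀ t : ℕ, binSeq p q (t + q ^ 2) = binSeq p q t := fun h => by
    have h1 := Function.Periodic.nat_mul h (p - 1) (1 + p * q)
    rw [binSeq_one_add_mul hp3 hq4, binSeq_eq_zero_of_dvd hp1 hq.pos] at h1
    · exact zero_ne_one h1
    · obtain ⟨c, hc⟩ := hdvd
      obtain rfl : q = p * c + 1 := by omega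
      obtain ⟨a, rfl⟩ : ∃ a, p = a + 1 := ⟨p - 1, by omega⟩
      refine ⟨((a + 1) * c + 1) + 1 + a * (c * ((a + 1) * c + 2)), ?_⟩
      simp only [Nat.add_sub_cancel, Nat.cast_id]
      ring
  refine ⟨hper, hpq, hqq, fun N hN h => ?_⟩
  by_contra! hlt
  have hMpos : 0 < p * q ^ 2 := by positivity
  have hne' : Nat.gcd N (p * q ^ 2) ≠ p * q ^ 2 := fun hg =>
    absurd (Nat.le_of_dvd hN (hg ▸ Nat.gcd_dvd_left N (p * q ^ 2))) (not_le.mpr hlt)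
  rcases dvd_mul_or_dvd_sq_of_dvd_mul_sq hp hq (Nat.gcd_dvd_right _ _) hne' with hd | hd
  · exact hpq (periodic_of_gcd_dvd hper h hMpos hd)
  · exact hqq (periodic_of_gcd_dvd hper h hMpos hd)
end

section
/- Let p and q be distinct odd primes with p dividing q − 1. For every integer ℓ with 0 ≤ ℓ < q, the set D_ℓ has exactly (p−1)(q−1) elements. In particular, the kernel D_0 of the Euler quotient homomorphism on the units modulo pq² has cardinality (p−1)(q−1). -/
/-- If `p ∣ q - 1`, then `t ^ ((p - 1) * (q - 1)) - 1` is divisible by `p ^ 2 * q` for every `t`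
coprime to `p * q`. -/
theorem exists_pow_eq_one_add_sq_mul {p q : ℕ} (hp : p.Prime) (hq : q.Prime) (hne : p ≠ q)
    (hdvd : p ∣ q - 1) {t : ℕ} (ht : Nat.gcd t (p * q) = 1) :
    ∃ c, t ^ ((p - 1) * (q - 1)) = 1 + p * q * (p * c) := by
  obtain ⟨htp, htq⟩ := Nat.coprime_mul_iff_right.mp ht
  have hmodp : t ^ ((p - 1) * (q - 1)) ≡ 1 [MOD p ^ 2] := by
    obtain ⟨m, hm⟩ := hdvd
    have h := (Nat.ModEq.pow_totient (htp.pow_right 2)).pow m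
    rwa [Nat.totient_prime_pow_succ hp, pow_one, ← pow_mul, one_pow, mul_comm p, mul_assoc,
      ← hm] at h
  have hmodq : t ^ ((p - 1) * (q - 1)) ≡ 1 [MOD q] := by
    have h := (Nat.ModEq.pow_totient htq).pow (p - 1)
    rwa [Nat.totient_prime hq, ← pow_mul, one_pow, mul_comm] at h
  have hcop : Nat.Coprime (p ^ 2) q := ((Nat.coprime_primes hp hq).mpr hne).pow_left 2
  have hmod := (Nat.modEq_and_modEq_iff_modEq_mul hcop).mp ⟨hmodp, hmodq⟩
  have hpos : 1 ≤ t ^ ((p - 1) * (q - 1)) := by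
    refine Nat.one_le_pow _ _ (Nat.pos_of_ne_zero ?_)
    rintro rfl
    exact hp.ne_one (by simpa using htp)
  obtain ⟨c, hc⟩ := (Nat.modEq_iff_dvd' hpos).mp hmod.symm
  exact ⟨c, by rw [← Nat.add_sub_of_le hpos, hc]; ring⟩

theorem eulerQuotient_modEq_iff {p q t c : ℕ} (hp : 0 < p) (hq : 0 < q)
    (ht : Nat.gcd t (p * q) = 1) (hc : t ^ ((p - 1) * (q - 1)) = 1 + p * q * (p * c)) (l : ℕ) :
    eulerQuotient p q t ≡ p * l [MOD p * q] ↔ (c : ZMod q) = l := by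
  rw [eulerQuotient, if_pos ht, hc, Nat.add_sub_cancel_left,
    Nat.mul_div_cancel_left _ (Nat.mul_pos hp hq), ZMod.natCast_eq_natCast_iff]
  constructor
  · intro h
    exact Nat.ModEq.mul_left_cancel' hp.ne' ((Nat.mod_modEq _ _).symm.trans h)
  · intro h
    exact (Nat.mod_modEq _ _).trans (h.mul_left' p)

/-- Shifting the base by `p * q * b` shifts the reduced Euler quotient linearly in `b`. -/
theorem cast_quotient_add_mul {p q n m a b c c' : ℕ} (hp : 0 < p) (hq : 0 < q) (hn : n = p * m)
    (hc : a ^ n = 1 + p * q * (p * c)) (hc' : (a + p * q * b) ^ n = 1 + p * q * (p * c')) :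
    (c' : ZMod q) = c + m * a ^ (n - 1) * b := by
  obtain ⟨k, hk⟩ := Polynomial.powAddExpansion a (p * q * b) n
  rw [hc', hc] at hk
  have h : c' = c + m * a ^ (n - 1) * b + q * (k * b ^ 2) := by
    have hpos : 0 < p ^ 2 * q := by positivity
    refine Nat.eq_of_mul_eq_mul_left hpos ?_
    have hk' : 1 + p * q * (p * c') =
        1 + p * q * (p * c) + (p * m) * a ^ (n - 1) * (p * q * b) + k * (p * q * b) ^ 2 := by
      rw [hk, ← hn, Nat.cast_id]
    nlinarith [hk']
  rw [h]
  push_cast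
  simp

theorem stmt_5 (p q : ℕ) (hp : p.Prime) (hq : q.Prime) (hpodd : Odd p) (hqodd : Odd q)
    (hne : p ≠ q) (hdvd : p ∣ q - 1) :
    ∀ ℓ : ℕ, ℓ < q → (Dset p q ℓ).card = (p - 1) * (q - 1) := by
  intro l _
  have : Fact q.Prime := ⟨hq⟩
  have hp0 := hp.pos
  have hq0 := hq.pos
  have hpq0 : 0 < p * q := Nat.mul_pos hp0 hq0
  obtain ⟨m, hm⟩ : p ∣ (p - 1) * (q - 1) := hdvd.mul_left _
  have hple : p ≤ q - 1 := Nat.le_of_dvd (Nat.sub_pos_of_lt hq.one_lt) hdvd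
  have hm0 : (m : ZMod q) ≠ 0 := by
    rw [Ne, ZMod.natCast_eq_zero_iff]
    intro h
    rcases hq.dvd_mul.mp (hm ▸ h.mul_left p : q ∣ (p - 1) * (q - 1)) with h | h
    · have := Nat.le_of_dvd (Nat.sub_pos_of_lt hp.one_lt) h
      omega
    · have := Nat.le_of_dvd (Nat.sub_pos_of_lt hq.one_lt) h
      omega
  have hslope {a : ℕ} (ha : Nat.gcd a (p * q) = 1) :
      (m * a ^ ((p - 1) * (q - 1) - 1) : ZMod q) ≠ 0 := by
    refine mul_ne_zero hm0 (pow_ne_zero _ ?_)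
    rw [Ne, ZMod.natCast_eq_zero_iff]
    exact (hq.coprime_iff_not_dvd).mp (Nat.coprime_mul_iff_right.mp ha).2.symm
  have hshift (a b : ℕ) : Nat.gcd (a + p * q * b) (p * q) = Nat.gcd a (p * q) := by simp
  have hcard : ((Finset.range (p * q)).filter (fun a => (p * q).Coprime a)).card =
      (p - 1) * (q - 1) := by
    rw [← Nat.totient_eq_card_coprime, Nat.totient_mul ((Nat.coprime_primes hp hq).mpr hne),
      Nat.totient_prime hp, Nat.totient_prime hq]
  rw [← hcard]
  refine Finset.card_bij (fun t _ => t % (p * q)) ?_ ?_ ?_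
  · intro t ht
    simp only [Dset, Finset.mem_filter, Finset.mem_range] at ht ⊢
    refine ⟨Nat.mod_lt _ hpq0, ?_⟩
    rw [Nat.coprime_comm, Nat.Coprime, ← hshift _ (t / (p * q)), Nat.mod_add_div]
    exact ht.2.1
  · intro t ht t' ht' heq
    simp only [Dset, Finset.mem_filter, Finset.mem_range] at ht ht' heq
    obtain ⟨hlt, hgcd, hmod⟩ := ht
    obtain ⟨hlt', hgcd', hmod'⟩ := ht'
    obtain ⟨c, hc⟩ := exists_pow_eq_one_add_sq_mul hp hq hne hdvd hgcd
    obtain ⟨c', hc'⟩ := exists_pow_eq_one_add_sq_mul hp hq hne hdvd hgcd'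
    rw [eulerQuotient_modEq_iff hp0 hq0 hgcd hc] at hmod
    rw [eulerQuotient_modEq_iff hp0 hq0 hgcd' hc'] at hmod'
    have hga : Nat.gcd (t % (p * q)) (p * q) = 1 := by
      rw [← hshift _ (t / (p * q)), Nat.mod_add_div]
      exact hgcd
    obtain ⟨d, hd⟩ := exists_pow_eq_one_add_sq_mul hp hq hne hdvd hga
    rw [← Nat.mod_add_div t (p * q)] at hc
    rw [← Nat.mod_add_div t' (p * q), ← heq] at hc'
    have h := cast_quotient_add_mul hp0 hq0 hm hd hc
    have h' := cast_quotient_add_mul hp0 hq0 hm hd hc'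
    rw [hmod] at h
    rw [hmod', h] at h'
    have hb := mul_left_cancel₀ (hslope hga) (add_left_cancel h')
    rw [ZMod.natCast_eq_natCast_iff] at hb
    have hb := hb.eq_of_lt_of_lt (Nat.div_lt_of_lt_mul (by rwa [mul_assoc, ← sq]))
      (Nat.div_lt_of_lt_mul (by rwa [mul_assoc, ← sq]))
    rw [← Nat.mod_add_div t (p * q), ← Nat.mod_add_div t' (p * q), heq, hb]
  · intro a ha
    simp only [Finset.mem_filter, Finset.mem_range] at ha
    obtain ⟨hlt, hcop⟩ := ha
    have hga : Nat.gcd a (p * q) = 1 := hcop.symm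
    obtain ⟨d, hd⟩ := exists_pow_eq_one_add_sq_mul hp hq hne hdvd hga
    set b := ((l - d) / (m * a ^ ((p - 1) * (q - 1) - 1)) : ZMod q).val with hbdef
    have hblt : b < q := ZMod.val_lt _
    have hgt : Nat.gcd (a + p * q * b) (p * q) = 1 := (hshift a b).trans hga
    obtain ⟨c, hc⟩ := exists_pow_eq_one_add_sq_mul hp hq hne hdvd hgt
    refine ⟨a + p * q * b, ?_, by simp [Nat.mod_eq_of_lt hlt]⟩
    simp only [Dset, Finset.mem_filter, Finset.mem_range]
    refine ⟨by nlinarith, hgt, ?_⟩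
    rw [eulerQuotient_modEq_iff hp0 hq0 hgt hc, cast_quotient_add_mul hp0 hq0 hm hd hc, hbdef,
      ZMod.natCast_zmod_val, mul_div_cancel₀ _ (hslope hga)]
    ring
end

section
/- Let p and q be distinct odd primes with p dividing q − 1, and let ĝ be an integer with gcd(ĝ, pq) = 1 and ψ(ĝ) ≡ p (mod pq). Then for every integer ℓ with 0 ≤ ℓ < q, the set D_ℓ equals the set {ĝ^ℓ · t mod pq² : t ∈ D_0}; moreover the sets D_0, D_1, ..., D_{q−1} partition the residues in {0, ..., pq² − 1} that are coprime to pq. -/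
theorem eulerQuotient_lt {p q : ℕ} (hp : p.Prime) (hq : q.Prime) (t : ℕ) :
    eulerQuotient p q t < p * q := by
  have := Nat.mul_pos hp.pos hq.pos
  unfold eulerQuotient
  split_ifs
  · exact Nat.mod_lt _ this
  · exact this

theorem pow_modEq_one_add_mul_eulerQuotient {p q t : ℕ} (hp : p.Prime) (hq : q.Prime)
    (hne : p ≠ q) (ht : t.Coprime (p * q)) :
    t ^ ((p - 1) * (q - 1)) ≡ 1 + p * q * eulerQuotient p q t [MOD (p * q) * (p * q)] := by
  have hφ : (p * q).totient = (p - 1) * (q - 1) := by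
    rw [Nat.totient_mul ((Nat.coprime_primes hp hq).2 hne), Nat.totient_prime hp,
      Nat.totient_prime hq]
  have h1 : t ^ ((p - 1) * (q - 1)) ≡ 1 [MOD p * q] := hφ ▸ Nat.ModEq.pow_totient ht
  have hpos : 1 ≤ t ^ ((p - 1) * (q - 1)) := by
    rcases Nat.eq_zero_or_pos t with rfl | h
    · have h2 : p * q = 1 := by simpa using ht
      exact absurd (Nat.eq_one_of_mul_eq_one_right h2) hp.ne_one
    · exact Nat.pow_pos h
  obtain ⟨k, hk⟩ := (Nat.modEq_iff_dvd' hpos).1 h1.symm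
  have hk' : t ^ ((p - 1) * (q - 1)) = 1 + p * q * k := by omega
  have he : eulerQuotient p q t = k % (p * q) := by
    unfold eulerQuotient
    rw [if_pos ht, hk, Nat.mul_div_cancel_left _ (Nat.mul_pos hp.pos hq.pos)]
  rw [hk', he]
  exact Nat.ModEq.add_left _ ((Nat.mod_modEq k (p * q)).symm.mul_left' (p * q))

theorem modEq_of_one_add_mul_modEq {m a b : ℕ} (hm : m ≠ 0)
    (h : 1 + m * a ≡ 1 + m * b [MOD m * m]) : a ≡ b [MOD m] :=
  Nat.ModEq.mul_left_cancel' hm (Nat.ModEq.add_left_cancel' 1 h)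

theorem eulerQuotient_mul {p q s t : ℕ} (hp : p.Prime) (hq : q.Prime) (hne : p ≠ q)
    (hs : s.Coprime (p * q)) (ht : t.Coprime (p * q)) :
    eulerQuotient p q (s * t) ≡ eulerQuotient p q s + eulerQuotient p q t [MOD p * q] := by
  apply modEq_of_one_add_mul_modEq (Nat.mul_pos hp.pos hq.pos).ne'
  refine (pow_modEq_one_add_mul_eulerQuotient hp hq hne (hs.mul_left ht)).symm.trans ?_
  rw [mul_pow]
  refine ((pow_modEq_one_add_mul_eulerQuotient hp hq hne hs).mul
    (pow_modEq_one_add_mul_eulerQuotient hp hq hne ht)).trans ?_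
  generalize eulerQuotient p q s = a
  generalize eulerQuotient p q t = b
  have h : (1 + p * q * a) * (1 + p * q * b)
      = 1 + p * q * (a + b) + (p * q) * (p * q) * (a * b) := by ring
  rw [h]
  simp [Nat.ModEq]

theorem eulerQuotient_pow {p q g : ℕ} (hp : p.Prime) (hq : q.Prime) (hne : p ≠ q)
    (hg : g.Coprime (p * q)) (n : ℕ) :
    eulerQuotient p q (g ^ n) ≡ n * eulerQuotient p q g [MOD p * q] := by
  induction n with
  | zero =>
    have h := eulerQuotient_mul hp hq hne (Nat.coprime_one_left (p * q))
      (Nat.coprime_one_left (p * q))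
    rw [mul_one] at h
    have h' : eulerQuotient p q 1 + 0 ≡ eulerQuotient p q 1 + eulerQuotient p q 1 [MOD p * q] := h
    simpa using (Nat.ModEq.add_left_cancel' _ h').symm
  | succ n ih =>
    rw [pow_succ, add_mul, one_mul]
    exact (eulerQuotient_mul hp hq hne (hg.pow_left n) hg).trans (ih.add_right _)

theorem pow_modEq_one_sq {p q t : ℕ} (hp : p.Prime) (hdvd : p ∣ q - 1) (ht : t.Coprime p) :
    t ^ ((p - 1) * (q - 1)) ≡ 1 [MOD p ^ 2] := by
  obtain ⟨k, hk⟩ := hdvd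
  have h : (p - 1) * (q - 1) = (p ^ 2).totient * k := by
    rw [Nat.totient_prime_pow hp two_pos, hk]
    simp
    ring
  rw [h, pow_mul]
  simpa using (Nat.ModEq.pow_totient (ht.pow_right 2)).pow k

theorem dvd_eulerQuotient {p q t : ℕ} (hp : p.Prime) (hq : q.Prime) (hne : p ≠ q)
    (hdvd : p ∣ q - 1) (ht : t.Coprime (p * q)) : p ∣ eulerQuotient p q t := by
  have h1 := (pow_modEq_one_add_mul_eulerQuotient hp hq hne ht).of_dvd
    (⟨q * q, by ring⟩ : p ^ 2 ∣ p * q * (p * q))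
  have h2 := h1.symm.trans (pow_modEq_one_sq hp hdvd (Nat.Coprime.coprime_mul_right_right ht))
  have h3 : p * q * eulerQuotient p q t ≡ 0 [MOD p ^ 2] := Nat.ModEq.add_left_cancel' 1 h2
  rw [Nat.modEq_zero_iff_dvd, pow_two, mul_assoc] at h3
  exact ((Nat.coprime_primes hp hq).2 hne).dvd_of_dvd_mul_left
    (Nat.dvd_of_mul_dvd_mul_left hp.pos h3)

theorem eulerQuotient_congr {p q s t : ℕ} (hp : p.Prime) (hq : q.Prime) (hne : p ≠ q)
    (hdvd : p ∣ q - 1) (hs : s.Coprime (p * q)) (ht : t.Coprime (p * q))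
    (hst : s ≡ t [MOD p * q ^ 2]) : eulerQuotient p q s ≡ eulerQuotient p q t [MOD p * q] := by
  apply modEq_of_one_add_mul_modEq (Nat.mul_pos hp.pos hq.pos).ne'
  refine (pow_modEq_one_add_mul_eulerQuotient hp hq hne hs).symm.trans
    (Nat.ModEq.trans ?_ (pow_modEq_one_add_mul_eulerQuotient hp hq hne ht))
  have hc : (p ^ 2).Coprime (q ^ 2) := ((Nat.coprime_primes hp hq).2 hne).pow 2 2
  have hm : p * q * (p * q) = p ^ 2 * q ^ 2 := by ring
  rw [hm, ← Nat.modEq_and_modEq_iff_modEq_mul hc]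
  exact ⟨(pow_modEq_one_sq hp hdvd (Nat.Coprime.coprime_mul_right_right hs)).trans
      (pow_modEq_one_sq hp hdvd (Nat.Coprime.coprime_mul_right_right ht)).symm,
    (hst.of_dvd (Dvd.intro_left _ rfl)).pow _⟩

theorem coprime_of_modEq {p q s t : ℕ} (hst : s ≡ t [MOD p * q ^ 2]) (hs : s.Coprime (p * q)) :
    t.Coprime (p * q) := by
  have h : s ≡ t [MOD p * q] := hst.of_dvd ⟨q, by ring⟩
  exact h.gcd_eq.symm.trans hs

theorem mem_Dset {p q ℓ t : ℕ} : t ∈ Dset p q ℓ ↔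
    t < p * q ^ 2 ∧ t.Coprime (p * q) ∧ eulerQuotient p q t ≡ p * ℓ [MOD p * q] := by
  simp [Dset, Nat.Coprime]

theorem Dset_eq_image {p q g : ℕ} (hp : p.Prime) (hq : q.Prime) (hne : p ≠ q)
    (hdvd : p ∣ q - 1) (hg : g.Coprime (p * q)) (hψ : eulerQuotient p q g ≡ p [MOD p * q])
    (ℓ : ℕ) : Dset p q ℓ = (Dset p q 0).image (fun t => g ^ ℓ * t % (p * q ^ 2)) := by
  have hpos : 0 < p * q ^ 2 := Nat.mul_pos hp.pos (Nat.pow_pos hq.pos)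
  have hgl := hg.pow_left ℓ
  have hψl : eulerQuotient p q (g ^ ℓ) ≡ p * ℓ [MOD p * q] :=
    (eulerQuotient_pow hp hq hne hg ℓ).trans (mul_comm p ℓ ▸ hψ.mul_left ℓ)
  ext t
  simp only [Finset.mem_image, mem_Dset]
  constructor
  · rintro ⟨hlt, hcop, ht⟩
    have hgl' : (g ^ ℓ).Coprime (p * q ^ 2) :=
      (Nat.Coprime.coprime_mul_right_right hgl).mul_right
        ((Nat.Coprime.coprime_mul_left_right hgl).pow_right 2)
    obtain ⟨y, -, hy⟩ := Nat.exists_mul_mod_eq_one_of_coprime hgl'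
      (by nlinarith [hp.two_le, hq.two_le])
    have hmod : g ^ ℓ * (y * t % (p * q ^ 2)) ≡ t [MOD p * q ^ 2] := by
      refine ((Nat.mod_modEq (y * t) (p * q ^ 2)).mul_left _).trans ?_
      have hy' : g ^ ℓ * y ≡ 1 [MOD p * q ^ 2] := by
        rw [Nat.ModEq, hy, Nat.mod_eq_of_lt (by nlinarith [hp.two_le, hq.two_le])]
      simpa [mul_assoc] using hy'.mul_right t
    have hcop' := coprime_of_modEq hmod.symm hcop
    have hs := Nat.Coprime.coprime_mul_left hcop'
    refine ⟨y * t % (p * q ^ 2), ⟨Nat.mod_lt _ hpos, hs, ?_⟩, ?_⟩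
    · have h := ((eulerQuotient_mul hp hq hne hgl hs).symm.trans
        (eulerQuotient_congr hp hq hne hdvd hcop' hcop hmod)).trans ht
      simpa using Nat.ModEq.add_left_cancel hψl (h : _ ≡ p * ℓ + 0 [MOD p * q])
    · exact Nat.mod_eq_of_modEq hmod hlt
  · rintro ⟨s, ⟨-, hs, hψs⟩, rfl⟩
    have hmod := Nat.mod_modEq (g ^ ℓ * s) (p * q ^ 2)
    have hcop := hgl.mul_left hs
    have hcop' := coprime_of_modEq hmod.symm hcop
    refine ⟨Nat.mod_lt _ hpos, hcop', ?_⟩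
    refine (eulerQuotient_congr hp hq hne hdvd hcop' hcop hmod).trans ?_
    simpa using (eulerQuotient_mul hp hq hne hgl hs).trans (hψl.add hψs)

theorem stmt_6 (p q : ℕ) (hp : p.Prime) (hq : q.Prime) (hpodd : Odd p) (hqodd : Odd q)
    (hne : p ≠ q) (hdvd : p ∣ q - 1) (ghat : ℕ) (hghatcop : Nat.gcd ghat (p * q) = 1)
    (hghat : eulerQuotient p q ghat ≡ p [MOD p * q]) :
    (∀ ℓ : ℕ, ℓ < q →
        Dset p q ℓ = (Dset p q 0).image (fun t => ghat ^ ℓ * t % (p * q ^ 2))) ∧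
    (∀ i j : ℕ, i < q → j < q → i ≠ j → Disjoint (Dset p q i) (Dset p q j)) ∧
    (Finset.range q).biUnion (Dset p q) =
      (Finset.range (p * q ^ 2)).filter (fun t => Nat.gcd t (p * q) = 1) := by
  refine ⟨fun ℓ _ => Dset_eq_image hp hq hne hdvd hghatcop hghat ℓ, fun i j hi hj hij => ?_, ?_⟩
  · refine Finset.disjoint_left.2 fun t hti htj => hij ?_
    have h := (mem_Dset.1 hti).2.2.symm.trans (mem_Dset.1 htj).2.2
    exact (Nat.ModEq.mul_left_cancel' hp.ne_zero h).eq_of_lt_of_lt hi hj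
  · ext t
    simp only [Finset.mem_biUnion, Finset.mem_range, Finset.mem_filter, mem_Dset]
    constructor
    · rintro ⟨_, _, hlt, hcop, _⟩
      exact ⟨hlt, hcop⟩
    · rintro ⟨hlt, hcop⟩
      obtain ⟨k, hk⟩ := dvd_eulerQuotient hp hq hne hdvd hcop
      have h := eulerQuotient_lt hp hq t
      rw [hk] at h
      exact ⟨k, Nat.lt_of_mul_lt_mul_left h, hlt, hcop, hk ▸ Nat.ModEq.refl _⟩
end

section
/- Let p and q be distinct odd primes with p dividing q − 1. For integers i, j with 0 ≤ i, j < q, if u is an integer with u mod pq² lying in D_j, then {u·v mod pq² : v ∈ D_i} = D_{(i+j) mod q}. -/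
theorem pow_modEq_one_mod_sq {p q : ℕ} (hp : p.Prime) (hdvd : p ∣ q - 1) {t : ℕ}
    (ht : t.Coprime p) : t ^ ((p - 1) * (q - 1)) ≡ 1 [MOD p ^ 2] := by
  obtain ⟨k, hk⟩ := hdvd
  have h := (Nat.ModEq.pow_totient (ht.pow_right 2)).pow k
  rw [Nat.totient_prime_pow hp two_pos, one_pow, ← pow_mul] at h
  have e : (p - 1) * (q - 1) = p ^ (2 - 1) * (p - 1) * k := by rw [hk]; ring
  rwa [e]

theorem pow_modEq_one_mod_mul {p q : ℕ} (hp : p.Prime) (hq : q.Prime) (hne : p ≠ q) {t : ℕ}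
    (ht : t.Coprime (p * q)) : t ^ ((p - 1) * (q - 1)) ≡ 1 [MOD p * q] := by
  have h := Nat.ModEq.pow_totient ht
  rwa [Nat.totient_mul ((Nat.coprime_primes hp hq).2 hne), Nat.totient_prime hp,
    Nat.totient_prime hq] at h

/-- The power defining the Euler quotient modulo `(p * q) ^ 2` depends only on the residue of the
base modulo `p * q ^ 2`. -/
theorem pow_modEq_pow_of_modEq {p q : ℕ} (hp : p.Prime) (hq : q.Prime) (hne : p ≠ q)
    (hdvd : p ∣ q - 1) {s t : ℕ} (hs : s.Coprime p) (ht : t.Coprime p)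
    (h : s ≡ t [MOD p * q ^ 2]) :
    s ^ ((p - 1) * (q - 1)) ≡ t ^ ((p - 1) * (q - 1)) [MOD (p * q) * (p * q)] := by
  have e : (p * q) * (p * q) = p ^ 2 * q ^ 2 := by ring
  rw [e, ← Nat.modEq_and_modEq_iff_modEq_mul
    (((Nat.coprime_primes hp hq).2 hne).pow 2 2)]
  exact ⟨(pow_modEq_one_mod_sq hp hdvd hs).trans (pow_modEq_one_mod_sq hp hdvd ht).symm,
    (h.of_mul_left p).pow _⟩

theorem mem_Dset_iff {p q : ℕ} (hp : p.Prime) (hq : q.Prime) (hne : p ≠ q) {t l : ℕ} :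
    t ∈ Dset p q l ↔ t < p * q ^ 2 ∧ t.Coprime (p * q) ∧
      t ^ ((p - 1) * (q - 1)) ≡ 1 + p * q * (p * l) [MOD (p * q) * (p * q)] := by
  simp only [Dset, Finset.mem_filter, Finset.mem_range, ← Nat.coprime_iff_gcd_eq_one]
  refine and_congr_right fun _ => and_congr_right fun ht => ?_
  have hN : p * q ≠ 0 := mul_ne_zero hp.ne_zero hq.ne_zero
  have hpos : 1 ≤ t ^ ((p - 1) * (q - 1)) := by
    refine Nat.one_le_iff_ne_zero.2 fun h0 => ?_
    have ht0 : t = 0 := eq_zero_of_pow_eq_zero h0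
    rw [ht0, Nat.coprime_zero_left] at ht
    exact hp.one_lt.ne' (Nat.eq_one_of_mul_eq_one_right ht)
  obtain ⟨F, hF⟩ := (Nat.modEq_iff_dvd' hpos).1 (pow_modEq_one_mod_mul hp hq hne ht).symm
  have hpow : t ^ ((p - 1) * (q - 1)) = 1 + p * q * F := by omega
  have hquot : eulerQuotient p q t = F % (p * q) := by
    rw [eulerQuotient, if_pos ht, hF, Nat.mul_div_cancel_left _ (Nat.pos_of_ne_zero hN)]
  rw [hquot, hpow, Nat.ModEq, Nat.mod_mod]
  exact ⟨fun h => (Nat.ModEq.mul_left' _ h).add_left 1,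
    fun h => Nat.ModEq.mul_left_cancel' hN (Nat.ModEq.add_left_cancel' 1 h)⟩

theorem one_add_mul_one_add_modEq (p q i j : ℕ) :
    (1 + p * q * (p * j)) * (1 + p * q * (p * i)) ≡
      1 + p * q * (p * ((i + j) % q)) [MOD (p * q) * (p * q)] := by
  have h : (i + j) % q + q * ((i + j) / q) = i + j := Nat.mod_add_div _ _
  generalize (i + j) % q = r at *
  generalize (i + j) / q = k at *
  have e : (1 + p * q * (p * j)) * (1 + p * q * (p * i)) =
      1 + p * q * (p * r) + (p * q) * (p * q) * (k + p * p * i * j) := by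
    calc _ = 1 + p * q * p * (i + j) + (p * q) * (p * q) * (p * p * i * j) := by ring
      _ = _ := by rw [← h]; ring
  rw [e]
  exact Nat.modEq_iff_dvd.2 ⟨-(k + p * p * i * j), by push_cast; ring⟩

theorem stmt_7 (p q : ℕ) (hp : p.Prime) (hq : q.Prime) (hpodd : Odd p) (hqodd : Odd q)
    (hne : p ≠ q) (hdvd : p ∣ q - 1) (i j : ℕ) (hi : i < q) (hj : j < q) (u : ℕ)
    (hu : u % (p * q ^ 2) ∈ Dset p q j) :
    (Dset p q i).image (fun v => u * v % (p * q ^ 2)) = Dset p q ((i + j) % q) := by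
  have hMpos : 0 < p * q ^ 2 := Nat.mul_pos hp.pos (pow_pos hq.pos 2)
  have hNM : p * q ∣ p * q ^ 2 := ⟨q, by ring⟩
  have hcop : ∀ {s t : ℕ}, s ≡ t [MOD p * q ^ 2] → s.Coprime (p * q) → t.Coprime (p * q) :=
    fun h hs => (Nat.ModEq.gcd_eq (h.of_dvd hNM)).symm.trans hs
  have hpow : ∀ {s t : ℕ}, s ≡ t [MOD p * q ^ 2] → s.Coprime (p * q) →
      s ^ ((p - 1) * (q - 1)) ≡ t ^ ((p - 1) * (q - 1)) [MOD (p * q) * (p * q)] :=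
    fun h hs => pow_modEq_pow_of_modEq hp hq hne hdvd hs.coprime_mul_right_right
      (hcop h hs).coprime_mul_right_right h
  obtain ⟨-, huc', hum'⟩ := (mem_Dset_iff hp hq hne).1 hu
  have huc : u.Coprime (p * q) := hcop (Nat.mod_modEq u _) huc'
  have hum := (hpow (Nat.mod_modEq u _) huc').symm.trans hum'
  ext w
  simp only [Finset.mem_image, mem_Dset_iff hp hq hne]
  constructor
  · rintro ⟨v, ⟨-, hvc, hvm⟩, rfl⟩
    have huv := (Nat.mod_modEq (u * v) (p * q ^ 2)).symm
    refine ⟨Nat.mod_lt _ hMpos, hcop huv (huc.mul_left hvc),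
      (hpow huv (huc.mul_left hvc)).symm.trans ?_⟩
    rw [mul_pow]
    exact (hum.mul hvm).trans (one_add_mul_one_add_modEq p q i j)
  · rintro ⟨hw, hwc, hwm⟩
    have hucM : u.Coprime (p * q ^ 2) :=
      huc.coprime_mul_right_right.mul_right (huc.coprime_mul_left_right.pow_right 2)
    obtain ⟨v, hv, ha⟩ := Nat.exists_mul_mod_eq_of_coprime w hucM hMpos.ne'
    have huv : w ≡ u * v [MOD p * q ^ 2] := ha.symm
    refine ⟨v, ⟨hv, (hcop huv hwc).coprime_mul_left, ?_⟩, ?_⟩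
    · have huN : Nat.gcd ((p * q) * (p * q)) (u ^ ((p - 1) * (q - 1))) = 1 :=
        ((huc.mul_right huc).pow_left _).symm
      refine Nat.ModEq.cancel_left_of_coprime huN ?_
      rw [← mul_pow]
      exact (hpow huv hwc).symm.trans (hwm.trans
        ((hum.mul_right _).trans (one_add_mul_one_add_modEq p q i j)).symm)
    · exact ha.trans (Nat.mod_eq_of_lt hw)
end

section
/- Let p and q be distinct odd primes with p dividing q − 1. For every ℓ with 0 ≤ ℓ < q and every integer a with 1 ≤ a < p (so gcd(a, p) = 1), the number of elements u ∈ D_ℓ with u ≡ a (mod p) is exactly q − 1. -/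
/-- In a finite cyclic group, a `d`-th power has exactly `gcd(|G|, d)` many `d`-th roots. -/
theorem natCard_pow_eq_of_isCyclic {G : Type*} [CommGroup G] [IsCyclic G] [Finite G] {d : ℕ}
    {x₀ g : G} (h : x₀ ^ d = g) : Nat.card {x : G // x ^ d = g} = (Nat.card G).gcd d := by
  rw [← IsCyclic.card_powMonoidHom_ker G d]
  refine Nat.card_congr ((Equiv.mulLeft x₀⁻¹).subtypeEquiv fun x => ?_)
  simp [MonoidHom.mem_ker, mul_pow, h, inv_mul_eq_one, eq_comm]

theorem exists_pow_eq_of_pow_eq_one {G : Type*} [Group G] {d n : ℕ} {g : G} (hd : d.Coprime n)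
    (h : g ^ n = 1) : ∃ x : G, x ^ d = g :=
  exists_pow_eq_self_of_coprime (hd.coprime_dvd_right (orderOf_dvd_of_pow_eq_one h)) |>.imp'
    (g ^ ·) fun m hm => by rw [← pow_mul, mul_comm, pow_mul, hm]

theorem coprime_pred_mul_pred {p q : ℕ} (hp : p.Prime) (hq : q.Prime) (hdvd : p ∣ q - 1) :
    ((p - 1) * (q - 1)).Coprime q := by
  have hp2 := hp.two_le
  have hq2 := hq.two_le
  have hle := Nat.le_of_dvd (by omega) hdvd
  refine Nat.Coprime.mul_left ?_ ?_
  · exact ((Nat.Prime.coprime_iff_not_dvd hq).2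
      (Nat.not_dvd_of_pos_of_lt (by omega) (by omega))).symm
  · exact ((Nat.Prime.coprime_iff_not_dvd hq).2
      (Nat.not_dvd_of_pos_of_lt (by omega) (by omega))).symm

theorem natCard_units_pow_eq {p q : ℕ} (hp : p.Prime) (hq : q.Prime) (hqodd : Odd q)
    (hdvd : p ∣ q - 1) {g : (ZMod (q ^ 2))ˣ} (hg : g ^ q = 1) :
    Nat.card {x : (ZMod (q ^ 2))ˣ // x ^ ((p - 1) * (q - 1)) = g} = q - 1 := by
  have : NeZero q := ⟨hq.ne_zero⟩
  have hcop := coprime_pred_mul_pred hp hq hdvd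
  have : IsCyclic (ZMod (q ^ 2))ˣ := ZMod.isCyclic_units_of_prime_pow q hq (by
    rintro rfl; exact absurd hqodd (by decide)) 2
  obtain ⟨x₀, hx₀⟩ := exists_pow_eq_of_pow_eq_one hcop hg
  rw [natCard_pow_eq_of_isCyclic hx₀, Nat.card_eq_fintype_card, ZMod.card_units_eq_totient,
    Nat.totient_prime_pow hq two_pos, show 2 - 1 = 1 from rfl, pow_one, Nat.gcd_mul_right,
    (Nat.Coprime.coprime_mul_right hcop).symm.gcd_eq_one, one_mul]

/-- For `t` coprime to `pq`, the congruence `ψ(t) ≡ pℓ` only depends on `t` modulo `q²`. -/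
theorem eulerQuotient_modEq_iff_s8 {p q t : ℕ} (hp : p.Prime) (hq : q.Prime) (hne : p ≠ q)
    (hdvd : p ∣ q - 1) (ℓ : ℕ) (ht : t.gcd (p * q) = 1) :
    eulerQuotient p q t ≡ p * ℓ [MOD p * q] ↔
      t ^ ((p - 1) * (q - 1)) ≡ 1 + p ^ 2 * q * ℓ [MOD q ^ 2] := by
  have hcpq : p.Coprime q := (Nat.coprime_primes hp hq).2 hne
  have htp : t.Coprime p := Nat.Coprime.coprime_mul_right_right ht
  have htq : t.Coprime q := Nat.Coprime.coprime_mul_left_right ht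
  have hpos : 0 < t := by
    rcases Nat.eq_zero_or_pos t with rfl | h
    · simp [hp.ne_one] at htp
    · exact h
  have h1 : t ^ ((p - 1) * (q - 1)) ≡ 1 [MOD p ^ 2] := by
    obtain ⟨c, hc⟩ := hdvd
    have := (Nat.ModEq.pow_totient (htp.pow_right 2)).pow c
    rw [Nat.totient_prime_pow hp two_pos, ← pow_mul, one_pow] at this
    convert this using 2
    rw [hc]; ring
  have h2 : t ^ ((p - 1) * (q - 1)) ≡ 1 [MOD q] := by
    have := (Nat.ModEq.pow_totient htq).pow (p - 1)
    rwa [Nat.totient_prime hq, ← pow_mul, one_pow, mul_comm] at this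
  have h3 := (Nat.modEq_and_modEq_iff_modEq_mul (hcpq.pow_left 2)).1 ⟨h1, h2⟩
  obtain ⟨s, hs⟩ := (Nat.modEq_iff_dvd' (Nat.pow_pos hpos)).1 h3.symm
  have hs' : t ^ ((p - 1) * (q - 1)) = 1 + p ^ 2 * q * s := by
    have := Nat.pow_pos (n := (p - 1) * (q - 1)) hpos
    omega
  have hdiv : p ^ 2 * q * s / (p * q) = p * s :=
    Nat.div_eq_of_eq_mul_right (Nat.mul_pos hp.pos hq.pos) (by ring)
  have hmod : eulerQuotient p q t ≡ p * s [MOD p * q] := by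
    rw [eulerQuotient, if_pos ht, hs, hdiv]
    exact Nat.mod_modEq _ _
  have key : s ≡ ℓ [MOD q] ↔ 1 + p ^ 2 * q * s ≡ 1 + p ^ 2 * q * ℓ [MOD q ^ 2] := by
    rw [show 1 + p ^ 2 * q * s = 1 + q * (p ^ 2 * s) by ring,
      show 1 + p ^ 2 * q * ℓ = 1 + q * (p ^ 2 * ℓ) by ring, sq q]
    refine ⟨fun h => ((h.mul_left _).mul_left' _).add_left _, fun h => ?_⟩
    exact Nat.ModEq.cancel_left_of_coprime (hcpq.pow_left 2).symm
      (Nat.ModEq.mul_left_cancel' hq.ne_zero (h.add_left_cancel' 1))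
  rw [hs', ← key, ← Nat.ModEq.mul_left_cancel_iff' (m := q) hp.ne_zero]
  exact ⟨hmod.symm.trans, hmod.trans⟩

theorem one_add_sq_mul_mul_pow_eq_one (p q ℓ : ℕ) :
    ((1 + p ^ 2 * q * ℓ : ℕ) : ZMod (q ^ 2)) ^ q = 1 := by
  have h := dvd_sub_pow_of_dvd_sub (R := ℤ) (p := q) (a := 1 + p ^ 2 * q * ℓ) (b := 1)
    ⟨p ^ 2 * ℓ, by ring⟩ 1
  rw [pow_one, one_pow] at h
  have := (ZMod.intCast_eq_intCast_iff_dvd_sub 1 ((1 + p ^ 2 * q * ℓ) ^ q) (q ^ 2)).2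
    (by rwa [Nat.cast_pow])
  push_cast at this ⊢
  exact this.symm

theorem stmt_8 (p q : ℕ) (hp : p.Prime) (hq : q.Prime) (hpodd : Odd p) (hqodd : Odd q)
    (hne : p ≠ q) (hdvd : p ∣ q - 1) (ℓ : ℕ) (hℓ : ℓ < q) (a : ℕ) (ha1 : 1 ≤ a)
    (ha2 : a < p) :
    ((Dset p q ℓ).filter (fun u => u ≡ a [MOD p])).card = q - 1 := by
  have : NeZero q := ⟨hq.ne_zero⟩
  have hcpq : p.Coprime q := (Nat.coprime_primes hp hq).2 hne
  have hco : p.Coprime (q ^ 2) := hcpq.pow_right 2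
  have hq2 : q ^ 2 ≠ 0 := pow_ne_zero 2 hq.ne_zero
  have hap : a.Coprime p := ((Nat.Prime.coprime_iff_not_dvd hp).2
    (Nat.not_dvd_of_pos_of_lt ha1 ha2)).symm
  have hg := one_add_sq_mul_mul_pow_eq_one p q ℓ
  let g : (ZMod (q ^ 2))ˣ := Units.ofPowEqOne _ q hg hq.ne_zero
  rw [← natCard_units_pow_eq hp hq hqodd hdvd (g := g) (Units.pow_ofPowEqOne hg hq.ne_zero),
    Nat.card_eq_fintype_card, Fintype.card_subtype]
  have pow_iff (u : ℕ) (x : (ZMod (q ^ 2))ˣ) (hu : (u : ZMod (q ^ 2)) = x) :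
      x ^ ((p - 1) * (q - 1)) = g ↔
        u ^ ((p - 1) * (q - 1)) ≡ 1 + p ^ 2 * q * ℓ [MOD q ^ 2] := by
    rw [← ZMod.natCast_eq_natCast_iff, Units.ext_iff, Nat.cast_pow, hu, Units.val_pow_eq_pow_val,
      Units.val_ofPowEqOne]
  let lift (x : (ZMod (q ^ 2))ˣ) : ℕ := Nat.chineseRemainder hco a (x : ZMod (q ^ 2)).val
  have lift_modEq (x : (ZMod (q ^ 2))ˣ) : lift x ≡ a [MOD p] :=
    (Nat.chineseRemainder hco a (x : ZMod (q ^ 2)).val).2.1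
  have cast_lift (x : (ZMod (q ^ 2))ˣ) : (lift x : ZMod (q ^ 2)) = x := by
    rw [(ZMod.natCast_eq_natCast_iff _ _ _).2
      (Nat.chineseRemainder hco a (x : ZMod (q ^ 2)).val).2.2, ZMod.natCast_zmod_val]
  symm
  refine Finset.card_bij (fun x _ => lift x) (fun x hx => ?_) (fun x _ y _ hxy => ?_)
    fun u hu => ?_
  · have hcop : (lift x).gcd (p * q) = 1 := by
      refine Nat.Coprime.mul_right ((lift_modEq x).gcd_eq.trans hap) ?_
      refine Nat.Coprime.coprime_dvd_right (dvd_pow_self q two_ne_zero) ?_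
      exact (ZMod.isUnit_iff_coprime _ _).1 (cast_lift x ▸ x.isUnit)
    simp only [Finset.mem_filter, Finset.mem_univ, true_and] at hx
    simp only [Dset, Finset.mem_filter, Finset.mem_range]
    exact ⟨⟨Nat.chineseRemainder_lt_mul hco _ _ hp.ne_zero hq2, hcop,
      (eulerQuotient_modEq_iff_s8 hp hq hne hdvd ℓ hcop).2 ((pow_iff _ x (cast_lift x)).1 hx)⟩,
      lift_modEq x⟩
  · exact Units.ext (by rw [← cast_lift x, ← cast_lift y, hxy])
  · simp only [Dset, Finset.mem_filter, Finset.mem_range] at hu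
    obtain ⟨⟨hlt, hcop, hψ⟩, hua⟩ := hu
    have huq : u.Coprime (q ^ 2) := (Nat.Coprime.coprime_mul_left_right hcop).pow_right 2
    let x := ZMod.unitOfCoprime u huq
    have hx : (u : ZMod (q ^ 2)) = x := (ZMod.coe_unitOfCoprime u huq).symm
    refine ⟨x, ?_, ?_⟩
    · simp only [Finset.mem_filter, Finset.mem_univ, true_and]
      exact (pow_iff u x hx).2 ((eulerQuotient_modEq_iff_s8 hp hq hne hdvd ℓ hcop).1 hψ)
    · have hmod := (Nat.modEq_and_modEq_iff_modEq_mul hco).1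
        ⟨(lift_modEq x).trans hua.symm, (ZMod.natCast_eq_natCast_iff _ _ _).1
          ((cast_lift x).trans hx.symm)⟩
      exact hmod.eq_of_lt_of_lt (Nat.chineseRemainder_lt_mul hco _ _ hp.ne_zero hq2) hlt
end

section
/- Let p and q be distinct odd primes. Let K be a field of characteristic 2 and γ ∈ K a primitive pq²-th root of unity. Then for every integer v with 0 ≤ v < pq², the sum Σ γ^{u·v}, taken over all u with 0 ≤ u < pq² and gcd(u, pq) = 1, equals 1 if gcd(v, pq²) = q and equals 0 otherwise. -/
lemma Nat.Coprime.mul_dvd_iff {m n k : ℕ} (h : Nat.Coprime m n) :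
    m * n ∣ k ↔ m ∣ k ∧ n ∣ k :=
  ⟨fun hk ↦ ⟨(Nat.dvd_mul_right m n).trans hk, (Nat.dvd_mul_left n m).trans hk⟩,
    fun hk ↦ h.mul_dvd_of_dvd_of_dvd hk.1 hk.2⟩

open Finset in
lemma sum_range_filter_dvd_eq {M : Type*} [AddCommMonoid M] (f : ℕ → M) {d : ℕ} (hd : 0 < d)
    (m : ℕ) : ∑ u ∈ range (d * m) with d ∣ u, f u = ∑ k ∈ range m, f (d * k) := by
  symm
  refine sum_nbij (d * ·) ?_ ?_ ?_ fun _ _ ↦ rfl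
  · intro k hk
    simpa [hd] using hk
  · exact fun a _ b _ h ↦ Nat.eq_of_mul_eq_mul_left hd h
  · rintro u hu
    obtain ⟨hu, k, rfl⟩ := by simpa using hu
    exact ⟨k, by simpa using Nat.lt_of_mul_lt_mul_left hu, rfl⟩

lemma IsPrimitiveRoot.sum_range_filter_dvd_pow_mul {R : Type*} [CommRing R] [IsDomain R] {ζ : R}
    {d m : ℕ} (hζ : IsPrimitiveRoot ζ (d * m)) (hd : 0 < d) (v : ℕ) :
    ∑ u ∈ Finset.range (d * m) with d ∣ u, ζ ^ (u * v) = if m ∣ v then (m : R) else 0 := by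
  rw [sum_range_filter_dvd_eq _ hd]
  have h_pow (k : ℕ) : ζ ^ (d * k * v) = (ζ ^ (d * v)) ^ k := by rw [← pow_mul]; congr 1; ring
  have h_one : ζ ^ (d * v) = 1 ↔ m ∣ v := by
    rw [hζ.pow_eq_one_iff_dvd, Nat.mul_dvd_mul_iff_left hd]
  simp_rw [h_pow]
  split_ifs with h
  · simp [h_one.2 h]
  · have h_geom := mul_geom_sum (ζ ^ (d * v)) m
    rw [← pow_mul, mul_right_comm, pow_mul _ (d * m), hζ.pow_eq_one, one_pow, sub_self] at h_geom
    exact (mul_eq_zero.1 h_geom).resolve_left (sub_ne_zero.2 (h_one.not.2 h))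

lemma CharTwo.natCast_eq_one_of_odd {R : Type*} [Ring R] [CharP R 2] {n : ℕ} (hn : Odd n) :
    (n : R) = 1 := by
  obtain ⟨k, rfl⟩ := hn
  simp

lemma IsPrimitiveRoot.sum_range_filter_dvd_pow_mul_charTwo {R : Type*} [CommRing R] [IsDomain R]
    [CharP R 2] {ζ : R} {n : ℕ} (hζ : IsPrimitiveRoot ζ n) (hn : Odd n) {d m : ℕ} (h : n = d * m)
    (v : ℕ) :
    ∑ u ∈ Finset.range n with d ∣ u, ζ ^ (u * v) = if m ∣ v then 1 else 0 := by
  subst h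
  obtain ⟨hd, hm⟩ := Nat.odd_mul.1 hn
  rw [hζ.sum_range_filter_dvd_pow_mul hd.pos, CharTwo.natCast_eq_one_of_odd hm]

lemma Nat.gcd_mul_eq_one_iff_of_prime {p q : ℕ} (hp : p.Prime) (hq : q.Prime) (u : ℕ) :
    Nat.gcd u (p * q) = 1 ↔ ¬ p ∣ u ∧ ¬ q ∣ u := by
  rw [← Nat.coprime_iff_gcd_eq_one, Nat.coprime_mul_iff_right, Nat.coprime_comm,
    hp.coprime_iff_not_dvd, Nat.coprime_comm, hq.coprime_iff_not_dvd]

lemma Nat.gcd_mul_sq_eq_iff_of_prime {p q : ℕ} (hp : p.Prime) (hq : q.Prime) (hne : p ≠ q)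
    (v : ℕ) : Nat.gcd v (p * q ^ 2) = q ↔ q ∣ v ∧ ¬ p ∣ v ∧ ¬ q ^ 2 ∣ v := by
  constructor
  · intro h
    have h_dvd {d : ℕ} (hd : d ∣ p * q ^ 2) (hv : d ∣ v) : d ∣ q := h ▸ Nat.dvd_gcd hv hd
    refine ⟨h ▸ Nat.gcd_dvd_left v _, fun hpv ↦ ?_, fun hqv ↦ ?_⟩
    · exact hne ((Nat.prime_dvd_prime_iff_eq hp hq).1 (h_dvd (Dvd.intro _ rfl) hpv))
    · have := Nat.le_of_dvd hq.pos (h_dvd (Dvd.intro_left _ rfl) hqv)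
      nlinarith [hq.two_le]
  · rintro ⟨⟨w, rfl⟩, hpv, hqv⟩
    have hqw : ¬ q ∣ w := fun h ↦ hqv (pow_two q ▸ Nat.mul_dvd_mul_left q h)
    have hpw : ¬ p ∣ w := fun h ↦ hpv (h.mul_left q)
    rw [show p * q ^ 2 = q * (p * q) by ring, Nat.gcd_mul_left,
      (Nat.gcd_mul_eq_one_iff_of_prime hp hq w).2 ⟨hpw, hqw⟩, mul_one]

theorem stmt_14 (p q : ℕ) (hp : p.Prime) (hq : q.Prime) (hpodd : Odd p) (hqodd : Odd q)
    (hne : p ≠ q) (K : Type*) [Field K] [CharP K 2] (γ : K)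
    (hγ : IsPrimitiveRoot γ (p * q ^ 2)) (v : ℕ) (hv : v < p * q ^ 2) :
    ∑ u ∈ (Finset.range (p * q ^ 2)).filter (fun u => Nat.gcd u (p * q) = 1),
        γ ^ (u * v) =
      if Nat.gcd v (p * q ^ 2) = q then 1 else 0 := by
  have hn : Odd (p * q ^ 2) := hpodd.mul hqodd.pow
  have hcop : Nat.Coprime p q := (Nat.coprime_primes hp hq).2 hne
  have h_two : (1 + 1 : K) = 0 := CharTwo.add_self_eq_zero 1
  have h_mul (u : ℕ) : p * q ∣ u ↔ p ∣ u ∧ q ∣ u := Nat.Coprime.mul_dvd_iff hcop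
  have h_mul_sq : p * q ^ 2 ∣ v ↔ p ∣ v ∧ q ^ 2 ∣ v := Nat.Coprime.mul_dvd_iff (hcop.pow_right 2)
  have h_sq : q ^ 2 ∣ v → q ∣ v := (dvd_pow_self q two_ne_zero).trans
  have h_split : ∑ u ∈ (Finset.range (p * q ^ 2)).filter (fun u => Nat.gcd u (p * q) = 1),
      γ ^ (u * v) =
        ∑ u ∈ Finset.range (p * q ^ 2) with 1 ∣ u, γ ^ (u * v) +
        ∑ u ∈ Finset.range (p * q ^ 2) with p ∣ u, γ ^ (u * v) +
        ∑ u ∈ Finset.range (p * q ^ 2) with q ∣ u, γ ^ (u * v) +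
        ∑ u ∈ Finset.range (p * q ^ 2) with p * q ∣ u, γ ^ (u * v) := by
    simp_rw [Finset.sum_filter, ← Finset.sum_add_distrib, h_mul,
      Nat.gcd_mul_eq_one_iff_of_prime hp hq]
    refine Finset.sum_congr rfl fun u _ ↦ ?_
    by_cases hpu : p ∣ u <;> by_cases hqu : q ∣ u <;>
      simp [hpu, hqu, CharTwo.add_self_eq_zero]
  rw [h_split, hγ.sum_range_filter_dvd_pow_mul_charTwo hn (one_mul _).symm,
    hγ.sum_range_filter_dvd_pow_mul_charTwo hn rfl,
    hγ.sum_range_filter_dvd_pow_mul_charTwo hn (show p * q ^ 2 = q * (p * q) by ring),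
    hγ.sum_range_filter_dvd_pow_mul_charTwo hn (show p * q ^ 2 = p * q * q by ring)]
  simp only [h_mul, h_mul_sq, Nat.gcd_mul_sq_eq_iff_of_prime hp hq hne]
  by_cases hpv : p ∣ v <;> by_cases hqv : q ∣ v <;> by_cases hqv2 : q ^ 2 ∣ v <;>
    simp_all
end

section
/- Let p and q be distinct odd primes with p dividing q − 1, and assume 2^{q−1} ≢ 1 (mod q²). Let K be a field of characteristic 2 containing a primitive pq²-th root of unity γ, and let s = (s_t) be the binary threshold sequence. Then for every integer v with gcd(v, pq²) = 1, the value Σ_{t=0}^{pq²−1} s_t · γ^{v·t} is nonzero in K; equivalently, the pq²-th cyclotomic polynomial over F₂ does not divide gcd(X^{pq²} − 1, Σ_{t=0}^{pq²−1} s_t X^t). -/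
namespace EulerQuotient

open Finset

lemma one_add_mul_pow_modEq (m x n : ℕ) :
    (1 + m * x) ^ n ≡ 1 + n * (m * x) [MOD m ^ 2] := by
  induction n with
  | zero => simp [Nat.ModEq.refl]
  | succ n ih =>
    rw [pow_succ]
    refine (ih.mul_right _).trans ?_
    have h : (1 + n * (m * x)) * (1 + m * x) =
        1 + (n + 1) * (m * x) + m ^ 2 * (n * x ^ 2) := by ring
    rw [h]
    exact Nat.add_modulus_mul_modEq_iff.mpr rfl

lemma pow_modEq_one {p q t : ℕ} (hp : p.Prime) (hq : q.Prime) (hne : p ≠ q)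
    (ht : t.Coprime (p * q)) : t ^ ((p - 1) * (q - 1)) ≡ 1 [MOD p * q] := by
  have h := Nat.ModEq.pow_totient ht
  rwa [Nat.totient_mul ((Nat.coprime_primes hp hq).2 hne), Nat.totient_prime hp,
    Nat.totient_prime hq] at h

lemma exists_two_pow_eq {p q : ℕ} (hp : p.Prime) (hq : q.Prime) (hpodd : Odd p)
    (hqodd : Odd q) (hne : p ≠ q) (hqp : ¬ q ∣ p - 1)
    (h2 : ¬ 2 ^ (q - 1) ≡ 1 [MOD q ^ 2]) :
    ∃ N, 2 ^ ((p - 1) * (q - 1)) = 1 + p * q * N ∧ ¬ q ∣ N := by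
  have hcop : Nat.Coprime 2 q := Nat.coprime_two_left.2 hqodd
  have h1 := pow_modEq_one hp hq hne (Nat.coprime_two_left.2 (hpodd.mul hqodd))
  obtain ⟨N, hN⟩ := (Nat.modEq_iff_dvd' Nat.one_le_two_pow).1 h1.symm
  have hN' : 2 ^ ((p - 1) * (q - 1)) = 1 + p * q * N := by
    have := Nat.one_le_two_pow (n := (p - 1) * (q - 1))
    omega
  refine ⟨N, hN', fun hqN => h2 ?_⟩
  have h3 : 2 ^ (q - 1) ≡ 1 [MOD q] := by
    simpa [Nat.totient_prime hq] using Nat.ModEq.pow_totient hcop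
  obtain ⟨M, hM⟩ := (Nat.modEq_iff_dvd' Nat.one_le_two_pow).1 h3.symm
  have hM' : 2 ^ (q - 1) = 1 + q * M := by
    have := Nat.one_le_two_pow (n := q - 1)
    omega
  have h4 := one_add_mul_pow_modEq q M (p - 1)
  rw [← hM', ← pow_mul, mul_comm (q - 1), hN'] at h4
  obtain ⟨c, rfl⟩ := hqN
  have h5 : 1 + p * q * (q * c) ≡ 1 [MOD q ^ 2] := by
    rw [show p * q * (q * c) = q ^ 2 * (p * c) by ring]
    exact Nat.add_modulus_mul_modEq_iff.mpr rfl
  have h6 : q ^ 2 ∣ (p - 1) * (q * M) := by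
    have := (Nat.modEq_iff_dvd' (by omega)).1 (h5.symm.trans h4)
    rwa [Nat.add_sub_cancel_left] at this
  have h7 : q ∣ (p - 1) * M := by
    rw [show (p - 1) * (q * M) = q * ((p - 1) * M) by ring, pow_two] at h6
    exact Nat.dvd_of_mul_dvd_mul_left hq.pos h6
  obtain ⟨d, rfl⟩ := (hq.dvd_mul.1 h7).resolve_left hqp
  rw [hM', show q * (q * d) = q ^ 2 * d by ring]
  exact Nat.add_modulus_mul_modEq_iff.mpr rfl

lemma eulerQuotient_eq {p q t κ ℓ : ℕ} (hp : p.Prime) (hq : q.Prime) (hne : p ≠ q)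
    (hdvd : p ∣ q - 1) (hκ : (p - 1) * κ + p ^ 2 ≡ 0 [MOD q]) (hℓ : ℓ < q)
    (htp : ¬ p ∣ t) (ht : t ≡ 1 + q * (κ * ℓ) [MOD q ^ 2]) :
    eulerQuotient p q t = p * ℓ := by
  have hpq : p.Coprime q := (Nat.coprime_primes hp hq).2 hne
  have htq : t.Coprime q := by
    have h : t ≡ 1 + q * (κ * ℓ) [MOD q] := ht.of_dvd (Dvd.intro_left _ (pow_two q).symm)
    rw [Nat.Coprime, h.gcd_eq]
    simp
  have htp' : t.Coprime p := ((hp.coprime_iff_not_dvd).2 htp).symm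
  have htc : t.Coprime (p * q) := htp'.mul_right htq
  set T := (p - 1) * (q - 1) with hT
  have hpos : 1 ≤ t ^ T := Nat.one_le_pow _ _ (Nat.pos_of_ne_zero (by rintro rfl; simp at htp))
  obtain ⟨N, hN⟩ := (Nat.modEq_iff_dvd' hpos).1 (pow_modEq_one hp hq hne htc).symm
  have hpqpos : 0 < p * q := Nat.mul_pos hp.pos hq.pos
  rw [eulerQuotient, if_pos htc, ← hT, hN, Nat.mul_div_cancel_left _ hpqpos]
  suffices h : N ≡ p * ℓ [MOD p * q] by
    rw [h, Nat.mod_eq_of_lt (Nat.mul_lt_mul_of_pos_left hℓ hp.pos)]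
  apply Nat.ModEq.mul_left_cancel' hpqpos.ne'
  rw [← hN, show p * q * (p * q) = p ^ 2 * q ^ 2 by ring]
  apply Nat.ModEq.add_left_cancel' 1
  rw [Nat.add_sub_cancel' hpos]
  rw [← Nat.modEq_and_modEq_iff_modEq_mul (Nat.Coprime.pow 2 2 hpq)]
  constructor
  · have h1 : t ^ T ≡ 1 [MOD p ^ 2] := by
      obtain ⟨d, hd⟩ := hdvd
      have h := Nat.ModEq.pow_totient (htp'.pow_right 2)
      rw [Nat.totient_prime_pow hp (by norm_num)] at h
      have h' := h.pow d
      rwa [one_pow, ← pow_mul, show p ^ (2 - 1) * (p - 1) * d = T by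
        rw [hT, hd]; norm_num; ring] at h'
    refine h1.trans ?_
    rw [show p * q * (p * ℓ) = p ^ 2 * (q * ℓ) by ring]
    exact (Nat.add_modulus_mul_modEq_iff.mpr rfl).symm
  · refine (ht.pow T).trans ((one_add_mul_pow_modEq q _ T).trans ?_)
    refine Nat.ModEq.add_left _ ?_
    rw [show T * (q * (κ * ℓ)) = q * (T * κ * ℓ) by ring,
      show p * q * (p * ℓ) = q * (p ^ 2 * ℓ) by ring, pow_two q]
    refine Nat.ModEq.mul_left' _ (Nat.ModEq.mul_right _ ?_)
    apply Nat.ModEq.add_right_cancel' ((p - 1) * κ)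
    rw [add_comm (p ^ 2)]
    refine Nat.ModEq.trans ?_ hκ.symm
    rw [hT, show (p - 1) * (q - 1) * κ + (p - 1) * κ = (q - 1 + 1) * ((p - 1) * κ) by ring,
      Nat.sub_add_cancel hq.one_le]
    exact (Nat.modEq_zero_iff_dvd).2 (dvd_mul_right _ _)

lemma binSeq_eq_zero_of_dvd {p q t : ℕ} (hp : p.Prime) (hq : 0 < q) (h : p ∣ t) :
    binSeq p q t = 0 := by
  have : Nat.gcd t (p * q) ≠ 1 := fun h1 =>
    hp.one_lt.ne' (Nat.dvd_one.1 (h1 ▸ Nat.dvd_gcd h (dvd_mul_right p q)))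
  simp [binSeq, eulerQuotient, this, hp.pos, hq]

lemma binSeq_eq {p q t κ ℓ : ℕ} (hp : p.Prime) (hq : q.Prime) (hne : p ≠ q)
    (hdvd : p ∣ q - 1) (hκ : (p - 1) * κ + p ^ 2 ≡ 0 [MOD q]) (hℓ : ℓ < q)
    (ht : t ≡ 1 + q * (κ * ℓ) [MOD q ^ 2]) :
    binSeq p q t = if q ≤ 2 * ℓ ∧ ¬ p ∣ t then 1 else 0 := by
  by_cases htp : p ∣ t
  · simp [binSeq_eq_zero_of_dvd hp hq.pos htp, htp]
  · have h : 2 * (p * ℓ) < p * q ↔ ¬ q ≤ 2 * ℓ := by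
      rw [show 2 * (p * ℓ) = p * (2 * ℓ) by ring, Nat.mul_lt_mul_left hp.pos, not_le]
    rw [binSeq, eulerQuotient_eq hp hq hne hdvd hκ hℓ htp ht]
    by_cases hl : q ≤ 2 * ℓ <;> simp [h, hl, htp]

lemma exists_slope {p q : ℕ} (hp : p.Prime) (hq : q.Prime) (hne : p ≠ q)
    (hqp : ¬ q ∣ p - 1) : ∃ κ, (p - 1) * κ + p ^ 2 ≡ 0 [MOD q] ∧ ¬ q ∣ κ := by
  obtain ⟨x, -, hx⟩ := Nat.exists_mul_mod_eq_one_of_coprime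
    ((hq.coprime_iff_not_dvd).2 hqp).symm hq.one_lt
  have hx' : (p - 1) * x ≡ 1 [MOD q] := by rw [Nat.ModEq, hx, Nat.mod_eq_of_lt hq.one_lt]
  have hκ : (p - 1) * (x * (p ^ 2 * (q - 1))) + p ^ 2 ≡ 0 [MOD q] := by
    rw [← mul_assoc]
    refine ((hx'.mul_right _).add_right _).trans ?_
    rw [show 1 * (p ^ 2 * (q - 1)) + p ^ 2 = (q - 1 + 1) * p ^ 2 by ring,
      Nat.sub_add_cancel hq.one_le]
    exact (Nat.modEq_zero_iff_dvd).2 (dvd_mul_right _ _)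
  refine ⟨_, hκ, fun h => ?_⟩
  have h1 := (Nat.dvd_add_right (h.mul_left (p - 1))).1 ((Nat.modEq_zero_iff_dvd).1 hκ)
  exact hne ((Nat.prime_dvd_prime_iff_eq hq hp).1 (hq.dvd_of_dvd_pow h1)).symm

lemma sum_range_mul {M : Type*} [AddCommMonoid M] (m n : ℕ) (f : ℕ → M) :
    ∑ i ∈ range (m * n), f i = ∑ j ∈ range n, ∑ i ∈ range m, f (m * j + i) := by
  induction n with
  | zero => simp
  | succ n ih => rw [Nat.mul_succ, sum_range_add, sum_range_succ, ih]

lemma geom_sum_pow_eq {K : Type*} [Field K] {q : ℕ} {ω : K} (hω : IsPrimitiveRoot ω q)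
    (m : ℕ) : ∑ j ∈ range q, (ω ^ m) ^ j = if q ∣ m then (q : K) else 0 := by
  split_ifs with h
  · rw [(hω.pow_eq_one_iff_dvd m).2 h]
    simp
  · have h1 : ω ^ m - 1 ≠ 0 := sub_ne_zero.2 fun h1 => h ((hω.pow_eq_one_iff_dvd m).1 h1)
    refine (mul_eq_zero.1 ?_).resolve_right h1
    rw [geom_sum_mul, ← pow_mul, mul_comm, pow_mul, hω.pow_eq_one, one_pow, sub_self]

lemma sum_filter_mod_eq_zero {K : Type*} [Field K] {q n : ℕ} (hq : 1 < q) (hqK : (q : K) ≠ 0)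
    {ω : K} (hω : IsPrimitiveRoot ω q) (F : ℕ → K)
    (h : ∀ j, ∑ t ∈ range n, F t * ω ^ (t * j) = 0) :
    ∑ t ∈ range n, (if t % q = 1 then F t else 0) = 0 := by
  refine (mul_eq_zero.1 ?_).resolve_left hqK
  calc (q : K) * ∑ t ∈ range n, (if t % q = 1 then F t else 0)
      = ∑ t ∈ range n, F t * ∑ j ∈ range q, (ω ^ (t + (q - 1))) ^ j := by
        rw [mul_sum]
        refine sum_congr rfl fun t _ => ?_
        have : q ∣ t + (q - 1) ↔ t % q = 1 := by
          rw [← Nat.modEq_zero_iff_dvd, show t + (q - 1) ≡ 0 [MOD q] ↔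
            t + (q - 1) ≡ 1 + (q - 1) [MOD q] by
              rw [Nat.add_sub_cancel' hq.le]; simp [Nat.ModEq]]
          constructor
          · intro h
            have := Nat.ModEq.add_right_cancel' _ h
            rwa [Nat.ModEq, Nat.mod_eq_of_lt hq] at this
          · intro h
            apply Nat.ModEq.add_right
            rwa [Nat.ModEq, Nat.mod_eq_of_lt hq]
        rw [geom_sum_pow_eq hω]
        simp only [this]
        split_ifs <;> ring
    _ = ∑ j ∈ range q, ω ^ ((q - 1) * j) * ∑ t ∈ range n, F t * ω ^ (t * j) := by
        simp only [mul_sum]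
        rw [sum_comm]
        refine sum_congr rfl fun j _ => sum_congr rfl fun t _ => ?_
        ring
    _ = 0 := by simp [h]

lemma sum_filter_not_dvd {K : Type*} [Field K] {p q e x : ℕ} (hp : p.Prime) {γ : K}
    (hγ : IsPrimitiveRoot γ (p * q ^ 2)) (hq : q.Prime) (hne : p ≠ q)
    (he : e = 1 + q ^ 2 * x) (hpe : p ∣ e) (u : ℕ) :
    ∑ b ∈ range p, (if p ∣ u + q ^ 2 * b then 0 else γ ^ (u + q ^ 2 * b)) = -γ ^ (e * u) := by
  have hcop : p.gcd (q ^ 2) = 1 := ((Nat.coprime_primes hp hq).2 hne).pow_right 2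
  have h0 : ∑ b ∈ range p, γ ^ (u + q ^ 2 * b) = 0 := by
    simp only [pow_add, pow_mul, ← mul_sum]
    rw [(hγ.pow (Nat.mul_pos hp.pos (pow_pos hq.pos 2)) (mul_comm _ _)).geom_sum_eq_zero
      hp.one_lt, mul_zero]
  set b₀ := (x * u) % p
  have hmod : u + q ^ 2 * b₀ ≡ e * u [MOD p * q ^ 2] := by
    rw [he, show (1 + q ^ 2 * x) * u = u + q ^ 2 * (x * u) by ring,
      mul_comm p]
    exact ((Nat.mod_modEq _ _).mul_left' _).add_left _
  have hdvd₀ : p ∣ u + q ^ 2 * b₀ := by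
    rw [← Nat.modEq_zero_iff_dvd]
    exact (hmod.of_dvd (dvd_mul_right _ _)).trans
      ((Nat.modEq_zero_iff_dvd).2 (hpe.mul_right u))
  have h1 : ∑ b ∈ range p, (if p ∣ u + q ^ 2 * b then γ ^ (u + q ^ 2 * b) else 0) =
      γ ^ (e * u) := by
    rw [sum_eq_single_of_mem b₀ (mem_range.2 (Nat.mod_lt _ hp.pos))]
    · rw [if_pos hdvd₀, pow_eq_pow_mod _ hγ.pow_eq_one, hmod, ← pow_eq_pow_mod _ hγ.pow_eq_one]
    · intro b hb hne
      refine if_neg fun hd => hne ?_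
      have h2 : q ^ 2 * b ≡ q ^ 2 * b₀ [MOD p] := Nat.ModEq.add_left_cancel' u
        (((Nat.modEq_zero_iff_dvd).2 hd).trans ((Nat.modEq_zero_iff_dvd).2 hdvd₀).symm)
      exact (Nat.ModEq.cancel_left_of_coprime hcop h2).eq_of_lt_of_lt (mem_range.1 hb)
        (Nat.mod_lt _ hp.pos)
  rw [← h1, eq_neg_iff_add_eq_zero, ← sum_add_distrib]
  refine Eq.trans ?_ h0
  refine sum_congr rfl fun b _ => ?_
  split_ifs <;> simp

lemma sum_range_mul_mod {M : Type*} [AddCommMonoid M] {q κ : ℕ} (hq : q.Prime)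
    (hκ : ¬ q ∣ κ) (f : ℕ → M) :
    ∑ ℓ ∈ range q, f (κ * ℓ % q) = ∑ a ∈ range q, f a := by
  have hmaps : ∀ ℓ ∈ range q, κ * ℓ % q ∈ range q := fun ℓ _ =>
    mem_range.2 (Nat.mod_lt _ hq.pos)
  have hinj : Set.InjOn (fun ℓ => κ * ℓ % q) (range q : Set ℕ) := by
    intro a ha b hb hab
    exact (Nat.ModEq.cancel_left_of_coprime ((hq.coprime_iff_not_dvd).2 hκ) hab).eq_of_lt_of_lt
      (mem_range.1 ha) (mem_range.1 hb)
  exact sum_nbij _ hmaps hinj (surjOn_of_injOn_of_card_le _ hmaps hinj le_rfl) fun _ _ => rfl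

lemma sum_binSeq_filter_mod_one {K : Type*} [Field K] [CharP K 2] {p q κ e x : ℕ} (hp : p.Prime)
    (hq : q.Prime) (hne : p ≠ q) (hdvd : p ∣ q - 1)
    (hκ : (p - 1) * κ + p ^ 2 ≡ 0 [MOD q]) (hqκ : ¬ q ∣ κ) {γ : K}
    (hγ : IsPrimitiveRoot γ (p * q ^ 2)) (he : e = 1 + q ^ 2 * x)
    (hpe : p ∣ e) :
    ∑ t ∈ range (p * q ^ 2), (if t % q = 1 then
        ZMod.castHom (dvd_refl 2) K (binSeq p q t) * γ ^ t else 0) =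
      -(γ ^ e * ∑ ℓ ∈ Ico ((q + 1) / 2) q, (γ ^ (e * q * κ)) ^ ℓ) := by
  have hIco : Ico ((q + 1) / 2) q = (range q).filter fun ℓ => q ≤ 2 * ℓ := by
    ext ℓ
    simp only [mem_Ico, mem_filter, mem_range]
    omega
  rw [show p * q ^ 2 = q * (q * p) by ring, sum_range_mul]
  have h1 : ∀ j ∈ range (q * p), (∑ i ∈ range q, if (q * j + i) % q = 1 then
      ZMod.castHom (dvd_refl 2) K (binSeq p q (q * j + i)) * γ ^ (q * j + i) else 0) =
      ZMod.castHom (dvd_refl 2) K (binSeq p q (1 + q * j)) * γ ^ (1 + q * j) := by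
    intro j _
    rw [sum_eq_single_of_mem 1 (mem_range.2 hq.one_lt)]
    · rw [if_pos (by rw [Nat.mul_add_mod, Nat.mod_eq_of_lt hq.one_lt]), add_comm]
    · intro i hi hi1
      rw [if_neg (by rwa [Nat.mul_add_mod, Nat.mod_eq_of_lt (mem_range.1 hi)])]
  rw [sum_congr rfl h1, sum_range_mul, sum_comm, ← sum_range_mul_mod hq hqκ, hIco, sum_filter,
    mul_sum, ← sum_neg_distrib]
  refine sum_congr rfl fun ℓ hℓ => ?_
  set a := κ * ℓ % q with ha
  have h2 : ∀ b ∈ range p, ZMod.castHom (dvd_refl 2) K (binSeq p q (1 + q * (q * b + a))) *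
      γ ^ (1 + q * (q * b + a)) = if q ≤ 2 * ℓ then
        (if p ∣ (1 + q * a) + q ^ 2 * b then 0 else γ ^ ((1 + q * a) + q ^ 2 * b)) else 0 := by
    intro b _
    have hmod : (1 + q * a) + q ^ 2 * b ≡ 1 + q * (κ * ℓ) [MOD q ^ 2] := by
      refine Nat.ModEq.trans (Nat.add_modulus_mul_modEq_iff.mpr rfl) (Nat.ModEq.add_left _ ?_)
      rw [pow_two]
      exact (Nat.mod_modEq _ _).mul_left' _
    rw [show 1 + q * (q * b + a) = (1 + q * a) + q ^ 2 * b by ring,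
      binSeq_eq hp hq hne hdvd hκ (mem_range.1 hℓ) hmod]
    by_cases h3 : q ≤ 2 * ℓ <;> by_cases h4 : p ∣ (1 + q * a) + q ^ 2 * b <;> simp [h3, h4]
  rw [sum_congr rfl h2]
  split_ifs with h3
  · have h4 : (γ ^ (e * q)) ^ q = 1 := by
      rw [← pow_mul, hγ.pow_eq_one_iff_dvd, mul_assoc, ← pow_two]
      exact mul_dvd_mul_right hpe _
    rw [sum_filter_not_dvd hp hγ hq hne he hpe, show e * (1 + q * a) = e + e * q * a by ring,
      pow_add, pow_mul γ (e * q) a, ha, ← pow_eq_pow_mod _ h4]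
    ring
  · simp

lemma sum_binSeq_mul_pow_ne_zero {K : Type*} [Field K] [CharP K 2] {p q : ℕ}
    (hp : p.Prime) (hq : q.Prime) (hpodd : Odd p) (hqodd : Odd q) (hne : p ≠ q)
    (hdvd : p ∣ q - 1) (h2 : ¬ 2 ^ (q - 1) ≡ 1 [MOD q ^ 2]) {γ : K} (hγ : IsPrimitiveRoot γ (p * q ^ 2)) :
    ∑ t ∈ range (p * q ^ 2), ZMod.castHom (dvd_refl 2) K (binSeq p q t) * γ ^ t ≠ 0 := by
  intro h0
  have hn : 0 < p * q ^ 2 := Nat.mul_pos hp.pos (pow_pos hq.pos 2)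
  have hqp : ¬ q ∣ p - 1 := fun h => by
    have h3 := Nat.le_of_dvd (Nat.sub_pos_of_lt hq.one_lt) hdvd
    have h4 := Nat.le_of_dvd (Nat.sub_pos_of_lt hp.one_lt) h
    omega
  have hqK : (q : K) ≠ 0 := fun h =>
    Nat.not_even_iff_odd.2 hqodd (even_iff_two_dvd.2 ((CharP.cast_eq_zero_iff K 2 q).1 h))
  obtain ⟨N, hN, hqN⟩ := exists_two_pow_eq hp hq hpodd hqodd hne hqp h2
  have hω : IsPrimitiveRoot (γ ^ (p * q * N)) q := by
    rw [pow_mul]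
    exact (hγ.pow hn (by ring)).pow_of_coprime _ ((hq.coprime_iff_not_dvd).2 hqN).symm
  obtain ⟨κ, hκ, hqκ⟩ := exists_slope hp hq hne hqp
  obtain ⟨w, -, hw⟩ := Nat.exists_mul_mod_eq_one_of_coprime
    (((Nat.coprime_primes hp hq).2 hne).symm.pow_left 2) hp.one_lt
  have hw' : q ^ 2 * w ≡ 1 [MOD p] := by rw [Nat.ModEq, hw, Nat.mod_eq_of_lt hp.one_lt]
  obtain ⟨e, he⟩ : ∃ e, e = 1 + q ^ 2 * (w * (p - 1)) := ⟨_, rfl⟩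
  have hpe : p ∣ e := by
    rw [← Nat.modEq_zero_iff_dvd, he, ← mul_assoc]
    refine ((hw'.mul_right _).add_left 1).trans ?_
    rw [one_mul, Nat.add_sub_cancel' hp.one_le]
    simp [Nat.ModEq]
  have hqe : ¬ q ∣ e := fun h => by
    rw [he, pow_two, mul_assoc, Nat.dvd_add_left (dvd_mul_right _ _)] at h
    exact hq.one_lt.ne' (Nat.dvd_one.1 h)
  have key := sum_filter_mod_eq_zero (n := p * q ^ 2) hq.one_lt hqK hω
    (fun t => ZMod.castHom (dvd_refl 2) K (binSeq p q t) * γ ^ t) fun j => by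
      have h3 := congrArg (· ^ 2 ^ ((p - 1) * (q - 1) * j)) h0
      simp only [sum_pow_char_pow, zero_pow (pow_pos two_pos _).ne'] at h3
      rw [← h3]
      refine sum_congr rfl fun t _ => ?_
      have hs : ZMod.castHom (dvd_refl 2) K (binSeq p q t) ^ 2 ^ ((p - 1) * (q - 1) * j) =
          ZMod.castHom (dvd_refl 2) K (binSeq p q t) := by
        rw [binSeq]
        split_ifs <;> simp
      have hmod : (1 + p * q * N) ^ j ≡ 1 + j * (p * q * N) [MOD p * q ^ 2] :=
        (one_add_mul_pow_modEq (p * q) N j).of_dvd (by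
          rw [mul_pow]
          exact mul_dvd_mul_right (dvd_pow_self p two_ne_zero) _)
      rw [mul_pow, hs, pow_mul 2, hN, ← pow_mul γ t, pow_eq_pow_mod (t * _) hγ.pow_eq_one,
        hmod.mul_left t, ← pow_eq_pow_mod _ hγ.pow_eq_one]
      ring
  rw [sum_binSeq_filter_mod_one hp hq hne hdvd hκ hqκ hγ he hpe, neg_eq_zero] at key
  have hγ0 : γ ≠ 0 := hγ.ne_zero hn.ne'
  have hgeom := (mul_eq_zero.1 key).resolve_left (pow_ne_zero _ hγ0)
  have h5 := geom_sum_Ico_mul (γ ^ (e * q * κ)) (m := (q + 1) / 2) (n := q)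
    (by have := hq.two_le; omega)
  rw [hgeom, zero_mul, eq_comm, sub_eq_zero, ← pow_mul, ← pow_mul,
    (hγ.pow_eq_one_iff_dvd (e * q * κ * q)).2, eq_comm, hγ.pow_eq_one_iff_dvd] at h5
  · have h6 : q * q ∣ q * (e * κ * ((q + 1) / 2)) := by
      refine (Dvd.intro_left p ?_).trans h5 |>.trans (dvd_of_eq ?_) <;> ring
    have h7 := Nat.dvd_of_mul_dvd_mul_left hq.pos h6
    have h8 := (hq.dvd_mul.1 h7).resolve_left fun h => (hq.dvd_mul.1 h).elim hqe hqκ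
    have h9 := Nat.le_of_dvd (by have := hq.two_le; omega) h8
    obtain ⟨c, hc⟩ := hqodd
    have := hq.two_le
    omega
  · rw [show e * q * κ * q = e * q ^ 2 * κ by ring]
    exact (mul_dvd_mul_right hpe _).mul_right _

end EulerQuotient

open Polynomial in
theorem stmt_16 (p q : ℕ) (hp : p.Prime) (hq : q.Prime) (hpodd : Odd p) (hqodd : Odd q)
    (hne : p ≠ q) (hdvd : p ∣ q - 1)
    (h2 : ¬ (2 ^ (q - 1) ≡ 1 [MOD q ^ 2]))
    (K : Type*) [Field K] [CharP K 2] (γ : K)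
    (hγ : IsPrimitiveRoot γ (p * q ^ 2)) :
    (∀ v : ℕ, Nat.gcd v (p * q ^ 2) = 1 →
      ∑ t ∈ Finset.range (p * q ^ 2),
          (ZMod.castHom (dvd_refl 2) K (binSeq p q t)) * γ ^ (v * t) ≠ 0) ∧
    ¬ (cyclotomic (p * q ^ 2) (ZMod 2) ∣
        EuclideanDomain.gcd ((X : (ZMod 2)[X]) ^ (p * q ^ 2) - 1)
          (∑ t ∈ Finset.range (p * q ^ 2), C (binSeq p q t) * X ^ t)) := by
  refine ⟨fun v hv => ?_, fun hdiv => ?_⟩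
  · simp only [pow_mul]
    exact EulerQuotient.sum_binSeq_mul_pow_ne_zero hp hq hpodd hqodd hne hdvd h2
      (hγ.pow_of_coprime v hv)
  · apply EulerQuotient.sum_binSeq_mul_pow_ne_zero hp hq hpodd hqodd hne hdvd h2 hγ
    have hroot := hγ.isRoot_cyclotomic (Nat.mul_pos hp.pos (pow_pos hq.pos 2))
    rw [← map_cyclotomic _ (ZMod.castHom (dvd_refl 2) K), IsRoot.def, eval_map] at hroot
    obtain ⟨g, hg⟩ := hdiv.trans (EuclideanDomain.gcd_dvd_right _ _)
    have h := congrArg (eval₂ (ZMod.castHom (dvd_refl 2) K) γ) hg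
    rw [eval₂_mul, hroot, zero_mul, eval₂_finsetSum] at h
    simpa only [eval₂_mul, eval₂_C, eval₂_pow, eval₂_X] using h
end
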